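/- Let α > -1/2, k ≥ 1, f ∈ C^∞(ℝ), x ≠ 0, and define I_1(x,f)(a) = ∫_{-|x|}^{|x|} Θ_0(x,y) τ_y f(a) |y|^{2α+1} dy and inductively I_k(x,f)(a) = ∫_{-|x|}^{|x|} Θ_0(x,y) I_{k−1}(y,f)(a) |y|^{2α+1} dy. Then Λ_α^k (I_k(x,f)) = R_k(x,f), i.e., I_k(x,f) is a k-fold Λ_α-antiderivative of the Taylor remainder R_k(x,f). -/

import Mathlib

open MeasureTheory

/-- The Dunkl operator on `ℝ` with parameter `α`, extended by continuity at `0`. -/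
noncomputable def dunklOp (α : ℝ) (f : ℝ → ℝ) : ℝ → ℝ := fun x =>
  if x = 0 then 2 * (α + 1) * deriv f 0
  else deriv f x + (2 * α + 1) / x * ((f x - f (-x)) / 2)

/-- The Dunkl–Taylor monomials. -/
noncomputable def dunklB (α : ℝ) (p : ℕ) (x : ℝ) : ℝ :=
  if Even p then (x / 2) ^ p / ((ascPochhammer ℝ (p / 2)).eval (α + 1) * (p / 2).factorial)
  else (x / 2) ^ p / ((ascPochhammer ℝ (p / 2 + 1)).eval (α + 1) * (p / 2).factorial)

/-- The kernel `Θ_0(x,y) = sgn(x)/(2|x|^{2α+1}) + sgn(y)/(2|y|^{2α+1})`. -/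
noncomputable def theta0 (α : ℝ) (x y : ℝ) : ℝ :=
  Real.sign x / (2 * |x| ^ (2 * α + 1)) + Real.sign y / (2 * |y| ^ (2 * α + 1))

/-- The iterated antiderivatives: `I_0(x,f) = τ_x f` (so that
`I_1(x,f)(a) = ∫_{-|x|}^{|x|} Θ_0(x,y) τ_y f(a) |y|^{2α+1} dy`), and inductively
`I_{k+1}(x,f)(a) = ∫_{-|x|}^{|x|} Θ_0(x,y) I_k(y,f)(a) |y|^{2α+1} dy`. -/
noncomputable def dunklI (α : ℝ) (τ : ℝ → (ℝ → ℝ) → ℝ → ℝ) (f : ℝ → ℝ) :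
    ℕ → ℝ → ℝ → ℝ
  | 0 => fun x a => τ x f a
  | k + 1 => fun x a =>
      ∫ y in (-|x|)..|x|, theta0 α x y * dunklI α τ f k y a * |y| ^ (2 * α + 1)

/-- Weighted averaging operator. -/
noncomputable def avgK (b : ℝ) (g : ℝ → ℝ) (x : ℝ) : ℝ := ∫ s in (0:ℝ)..1, g (x * s) * s ^ b

theorem avgK_hasDerivAt {b : ℝ} (hb : 0 ≤ b) {g : ℝ → ℝ} (hg : ContDiff ℝ 1 g) (x : ℝ) :
    HasDerivAt (avgK b g) (avgK (b + 1) (deriv g) x) x := by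
  have hc := hg.continuous
  have hc' : Continuous (deriv g) := hg.continuous_deriv le_rfl
  have hpow : Continuous fun s : ℝ => s ^ b := Real.continuous_rpow_const hb
  obtain ⟨C, hC⟩ := (isCompact_Icc (a := -(|x| + 1)) (b := |x| + 1)).exists_bound_of_continuousOn
    hc'.continuousOn
  have key := intervalIntegral.hasDerivAt_integral_of_dominated_loc_of_deriv_le
    (μ := volume) (a := (0:ℝ)) (b := 1) (F := fun y s => g (y * s) * s ^ b)
    (F' := fun y s => deriv g (y * s) * s * s ^ b) (x₀ := x) (s := Metric.ball x 1)
    (bound := fun s => C)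
    (Metric.ball_mem_nhds x one_pos)
    (Filter.Eventually.of_forall fun y => by
      exact (Continuous.aestronglyMeasurable (by fun_prop)))
    (Continuous.intervalIntegrable (by fun_prop) _ _)
    (Continuous.aestronglyMeasurable (by fun_prop))
    (by
      refine Filter.Eventually.of_forall fun s hs y hy => ?_
      rw [Set.uIoc_of_le zero_le_one] at hs
      have hy' : |y| ≤ |x| + 1 := by
        rw [Metric.mem_ball, Real.dist_eq] at hy
        have := abs_sub_abs_le_abs_sub y x
        linarith
      have h1 : |y * s| ≤ |x| + 1 := by
        rw [abs_mul, abs_of_pos hs.1]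
        nlinarith [hs.1, hs.2, abs_nonneg y]
      have h2 := hC (y * s) (abs_le.1 h1)
      have h3 : s ^ b ≤ 1 := Real.rpow_le_one hs.1.le hs.2 hb
      have h4 : 0 ≤ s ^ b := Real.rpow_nonneg hs.1.le b
      rw [norm_mul, norm_mul, Real.norm_of_nonneg hs.1.le, Real.norm_of_nonneg h4]
      have h0 := norm_nonneg (deriv g (y * s))
      calc ‖deriv g (y * s)‖ * s * s ^ b ≤ ‖deriv g (y * s)‖ * 1 * 1 := by
            gcongr
            exact hs.2
        _ ≤ C := by linarith)
    (by simp)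
    (by
      refine Filter.Eventually.of_forall fun s hs y hy => ?_
      have h1 : HasDerivAt (fun y : ℝ => y * s) s y := hasDerivAt_mul_const s
      have h2 := ((hg.differentiable one_ne_zero (y * s)).hasDerivAt).comp y h1
      exact h2.mul_const _)
  suffices hval : avgK (b + 1) (deriv g) x = ∫ s in (0:ℝ)..1, deriv g (x * s) * s * s ^ b by
    rw [hval]
    exact key.2
  unfold avgK
  refine intervalIntegral.integral_congr_ae (Filter.Eventually.of_forall fun s hs => ?_)
  rw [Set.uIoc_of_le zero_le_one] at hs
  rw [Real.rpow_add_one hs.1.ne']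
  ring

theorem avgK_contDiff_nat (n : ℕ) : ∀ {b : ℝ}, 0 ≤ b → ∀ {g : ℝ → ℝ},
    ContDiff ℝ (⊤ : ℕ∞) g → ContDiff ℝ n (avgK b g) := by
  induction n with
  | zero =>
    intro b hb g hg
    have hg1 : ContDiff ℝ 1 g := hg.of_le (by exact_mod_cast le_top)
    exact contDiff_zero.2 (continuous_iff_continuousAt.2 fun x =>
      (avgK_hasDerivAt hb hg1 x).continuousAt)
  | succ n ih =>
    intro b hb g hg
    have hg1 : ContDiff ℝ 1 g := hg.of_le (by exact_mod_cast le_top)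
    have hd : deriv (avgK b g) = avgK (b + 1) (deriv g) :=
      funext fun x => (avgK_hasDerivAt hb hg1 x).deriv
    push_cast
    rw [contDiff_succ_iff_deriv]
    refine ⟨fun x => (avgK_hasDerivAt hb hg1 x).differentiableAt, by simp, ?_⟩
    rw [hd]
    exact ih (by linarith) (contDiff_infty_iff_deriv.1 hg).2

theorem avgK_contDiff {b : ℝ} (hb : 0 ≤ b) {g : ℝ → ℝ} (hg : ContDiff ℝ (⊤ : ℕ∞) g) :
    ContDiff ℝ (⊤ : ℕ∞) (avgK b g) :=
  contDiff_infty.2 fun n => avgK_contDiff_nat n hb hg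

/-- The Euler-type identity for the averaging operator. -/
theorem avgK_euler {b : ℝ} (hb : 0 ≤ b) {g : ℝ → ℝ} (hg : ContDiff ℝ (⊤ : ℕ∞) g) (x : ℝ) :
    (b + 1) * avgK b g x + x * avgK (b + 1) (deriv g) x = g x := by
  have hg1 : ContDiff ℝ 1 g := hg.of_le (by exact_mod_cast le_top)
  have hc := hg1.continuous
  have hc' : Continuous (deriv g) := hg1.continuous_deriv le_rfl
  have hpow : Continuous fun s : ℝ => s ^ b := Real.continuous_rpow_const hb
  have hpow' : Continuous fun s : ℝ => s ^ (b + 1) := Real.continuous_rpow_const (by linarith)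
  have key := intervalIntegral.integral_eq_sub_of_hasDerivAt (a := (0:ℝ)) (b := 1)
    (f := fun s => g (x * s) * s ^ (b + 1))
    (f' := fun s => deriv g (x * s) * x * s ^ (b + 1) + g (x * s) * ((b + 1) * s ^ b))
    (fun s _ => by
      have h1 : HasDerivAt (fun s : ℝ => x * s) x s := by
        simpa using (hasDerivAt_id s).const_mul x
      have h2 := ((hg1.differentiable one_ne_zero (x * s)).hasDerivAt).comp s h1
      have h3 : HasDerivAt (fun s : ℝ => s ^ (b + 1)) ((b + 1) * s ^ b) s := by
        have := Real.hasDerivAt_rpow_const (x := s) (p := b + 1) (Or.inr (by linarith))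
        simpa using this
      exact h2.mul h3)
    (Continuous.intervalIntegrable (by fun_prop) _ _)
  rw [intervalIntegral.integral_add (Continuous.intervalIntegrable (by fun_prop) _ _)
    (Continuous.intervalIntegrable (by fun_prop) _ _)] at key
  have e1 : ∫ s in (0:ℝ)..1, deriv g (x * s) * x * s ^ (b + 1) = x * avgK (b + 1) (deriv g) x := by
    unfold avgK
    rw [← intervalIntegral.integral_const_mul]
    congr 1; ext s; ring
  have e2 : ∫ s in (0:ℝ)..1, g (x * s) * ((b + 1) * s ^ b) = (b + 1) * avgK b g x := by
    unfold avgK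
    rw [← intervalIntegral.integral_const_mul]
    congr 1; ext s; ring
  rw [e1, e2] at key
  simp only [mul_one, Real.one_rpow, mul_zero] at key
  rw [Real.zero_rpow (by linarith)] at key
  linarith

theorem avgK_zero_mul {g : ℝ → ℝ} (hg : ContDiff ℝ (⊤ : ℕ∞) g) (x : ℝ) :
    x * avgK 0 (deriv g) x = g x - g 0 := by
  have hg1 : ContDiff ℝ 1 g := hg.of_le (by exact_mod_cast le_top)
  have hc' : Continuous (deriv g) := hg1.continuous_deriv le_rfl
  unfold avgK
  simp only [Real.rpow_zero, mul_one]
  rw [intervalIntegral.mul_integral_comp_mul_left]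
  rw [intervalIntegral.integral_deriv_eq_sub (fun y _ => hg1.differentiable one_ne_zero y)
    (hc'.intervalIntegrable _ _)]
  simp

theorem dunklOp_eq_avgK (α : ℝ) {g : ℝ → ℝ} (hg : ContDiff ℝ (⊤ : ℕ∞) g) :
    dunklOp α g = fun x => deriv g x +
      (2 * α + 1) / 2 * (avgK 0 (deriv g) x + avgK 0 (deriv g) (-x)) := by
  ext x
  unfold dunklOp
  split_ifs with h
  · subst h
    simp [avgK]
    ring
  · have h1 := avgK_zero_mul hg x
    have h2 := avgK_zero_mul hg (-x)
    field_simp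
    linear_combination (-(2 * α + 1)) * h1 + (2 * α + 1) * h2

theorem dunklOp_contDiff (α : ℝ) {g : ℝ → ℝ} (hg : ContDiff ℝ (⊤ : ℕ∞) g) :
    ContDiff ℝ (⊤ : ℕ∞) (dunklOp α g) := by
  rw [dunklOp_eq_avgK α hg]
  have hd : ContDiff ℝ (⊤ : ℕ∞) (deriv g) := (contDiff_infty_iff_deriv.1 hg).2
  have hk := avgK_contDiff le_rfl hd
  exact hd.add (contDiff_const.mul (hk.add (hk.comp contDiff_neg)))

theorem dunklOp_iterate_contDiff (α : ℝ) (n : ℕ) : ∀ {g : ℝ → ℝ}, ContDiff ℝ (⊤ : ℕ∞) g →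
    ContDiff ℝ (⊤ : ℕ∞) ((dunklOp α)^[n] g) := by
  induction n with
  | zero => intro g hg; exact hg
  | succ n ih => intro g hg; rw [Function.iterate_succ_apply]; exact ih (dunklOp_contDiff α hg)

theorem dunklOp_surj {α : ℝ} (hα : -1/2 < α) {f : ℝ → ℝ} (hf : ContDiff ℝ (⊤ : ℕ∞) f) :
    ∃ F : ℝ → ℝ, ContDiff ℝ (⊤ : ℕ∞) F ∧ dunklOp α F = f := by
  have hb : 0 ≤ 2 * α + 1 := by linarith
  obtain ⟨b, hbdef⟩ : ∃ b, b = 2 * α + 1 := ⟨_, rfl⟩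
  rw [← hbdef] at hb
  have hα' : α = (b - 1) / 2 := by linarith
  obtain ⟨e, he⟩ : ∃ e : ℝ → ℝ, e = fun x => (f x + f (-x)) / 2 := ⟨_, rfl⟩
  obtain ⟨o, ho⟩ : ∃ o : ℝ → ℝ, o = fun x => (f x - f (-x)) / 2 := ⟨_, rfl⟩
  have hfn : ContDiff ℝ (⊤ : ℕ∞) fun x => f (-x) := hf.comp contDiff_neg
  have hes : ContDiff ℝ (⊤ : ℕ∞) e := by rw [he]; exact (hf.add hfn).div_const 2
  have hos : ContDiff ℝ (⊤ : ℕ∞) o := by rw [ho]; exact (hf.sub hfn).div_const 2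
  have hke := avgK_contDiff hb hes
  have hko := avgK_contDiff le_rfl hos
  have heven : ∀ x, avgK b e (-x) = avgK b e x := by
    intro x
    unfold avgK
    congr 1; ext s
    simp only [he, neg_mul, neg_neg, add_comm]
  have hodd : ∀ x, avgK 0 o (-x) = - avgK 0 o x := by
    intro x
    unfold avgK
    rw [← intervalIntegral.integral_neg]
    congr 1; ext s
    simp only [ho, neg_mul, neg_neg]
    ring
  refine ⟨fun x => x * (avgK 0 o x + avgK b e x), contDiff_id.mul (hko.add hke), ?_⟩
  have hder : ∀ x, deriv (fun x => x * (avgK 0 o x + avgK b e x)) x =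
      f x - b * avgK b e x := by
    intro x
    have h1 := avgK_hasDerivAt le_rfl (hos.of_le (by exact_mod_cast le_top)) x
    have h2 := avgK_hasDerivAt hb (hes.of_le (by exact_mod_cast le_top)) x
    have h3 := ((hasDerivAt_id x).mul (h1.add h2)).deriv
    have e1 := avgK_euler le_rfl hos x
    have e2 := avgK_euler hb hes x
    have e3 : f x = o x + e x := by simp only [ho, he]; ring
    refine h3.trans ?_
    simp only [id, Pi.add_apply]
    rw [e3]
    linear_combination e1 + e2
  ext x
  unfold dunklOp
  rw [hder, hder]
  beta_reduce
  rw [heven, hodd, ← hbdef]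
  split_ifs with h
  · subst h
    have e2 := avgK_euler hb hes 0
    have : e 0 = f 0 := by simp [he]
    rw [this] at e2
    have : b * (f 0 - (b + 1) * avgK b e 0) = 0 := by rw [← e2]; ring
    rw [hα']
    linear_combination this
  · field_simp
    ring

theorem dunklOp_iterate_surj {α : ℝ} (hα : -1/2 < α) (n : ℕ) : ∀ {f : ℝ → ℝ},
    ContDiff ℝ (⊤ : ℕ∞) f →
    ∃ F : ℝ → ℝ, ContDiff ℝ (⊤ : ℕ∞) F ∧ (dunklOp α)^[n] F = f := by
  induction n with
  | zero => intro f hf; exact ⟨f, hf, rfl⟩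
  | succ n ih =>
    intro f hf
    obtain ⟨G, hG, rfl⟩ := ih hf
    obtain ⟨F, hF, rfl⟩ := dunklOp_surj hα hG
    exact ⟨F, hF, rfl⟩

theorem dunklOp_sub (α : ℝ) {u v : ℝ → ℝ} (hu : Differentiable ℝ u) (hv : Differentiable ℝ v) :
    dunklOp α (fun a => u a - v a) = fun a => dunklOp α u a - dunklOp α v a := by
  ext a
  unfold dunklOp
  have : ∀ a, deriv (fun a => u a - v a) a = deriv u a - deriv v a :=
    fun a => deriv_fun_sub (hu a) (hv a)
  rw [this, this]
  split_ifs <;> ring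

theorem dunklOp_add (α : ℝ) {u v : ℝ → ℝ} (hu : Differentiable ℝ u) (hv : Differentiable ℝ v) :
    dunklOp α (fun a => u a + v a) = fun a => dunklOp α u a + dunklOp α v a := by
  ext a
  unfold dunklOp
  have : ∀ a, deriv (fun a => u a + v a) a = deriv u a + deriv v a :=
    fun a => deriv_fun_add (hu a) (hv a)
  rw [this, this]
  split_ifs <;> ring

theorem dunklOp_const_mul (α c : ℝ) (u : ℝ → ℝ) :
    dunklOp α (fun a => c * u a) = fun a => c * dunklOp α u a := by
  ext a
  unfold dunklOp
  have : ∀ a, deriv (fun a => c * u a) a = c * deriv u a :=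
    fun a => deriv_const_mul_field c
  rw [this, this]
  split_ifs <;> ring

theorem dunklOp_sum (α : ℝ) (c : ℕ → ℝ) (u : ℕ → ℝ → ℝ) (hu : ∀ n, Differentiable ℝ (u n))
    (k : ℕ) : dunklOp α (fun a => ∑ q ∈ Finset.range k, c q * u q a) =
      fun a => ∑ q ∈ Finset.range k, c q * dunklOp α (u q) a := by
  induction k with
  | zero => ext a; simp [dunklOp]
  | succ k ih =>
    simp only [Finset.sum_range_succ]
    rw [dunklOp_add α (Differentiable.fun_sum fun q _ => (hu q).const_mul _)
      ((hu k).const_mul _), ih, dunklOp_const_mul]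

theorem dunklOp_id (α : ℝ) : dunklOp α (fun a => a) = fun _ => 2 * (α + 1) := by
  ext a
  unfold dunklOp
  split_ifs with h
  · simp
  · simp
    field_simp
    ring

theorem dunklOp_const (α c : ℝ) : dunklOp α (fun _ => c) = fun _ => 0 := by
  ext a
  unfold dunklOp
  simp

/-- The recursion for the Taylor remainders. -/
def DunklRec (α : ℝ) (τ : ℝ → (ℝ → ℝ) → ℝ → ℝ) : Prop :=
  ∀ (j : ℕ), 1 ≤ j → ∀ g : ℝ → ℝ, ContDiff ℝ (⊤ : ℕ∞) g → ∀ x : ℝ, x ≠ 0 → ∀ a : ℝ,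
      τ x g a - ∑ q ∈ Finset.range j, dunklB α q x * (dunklOp α)^[q] g a =
        ∫ y in (-|x|)..|x|,
          theta0 α x y *
            (τ y (dunklOp α g) a -
              ∑ q ∈ Finset.range (j - 1), dunklB α q y * (dunklOp α)^[q] (dunklOp α g) a) *
            |y| ^ (2 * α + 1)

theorem integral_congr_ne_zero {u v : ℝ → ℝ} (h : ∀ y, y ≠ 0 → u y = v y) (p q : ℝ) :
    ∫ y in p..q, u y = ∫ y in p..q, v y := by
  refine intervalIntegral.integral_congr_ae ?_
  have : ∀ᵐ y : ℝ ∂volume, y ≠ 0 := by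
    simp [ae_iff]
  filter_upwards [this] with y hy _ using h y hy

theorem tau_add_const {α : ℝ} {τ : ℝ → (ℝ → ℝ) → ℝ → ℝ} (hrec : DunklRec α τ) {g : ℝ → ℝ}
    (hg : ContDiff ℝ (⊤ : ℕ∞) g) (c x : ℝ) (hx : x ≠ 0) (a : ℝ) :
    τ x (fun a => g a + c) a = τ x g a + c := by
  have hgd : Differentiable ℝ g := hg.differentiable (by simp)
  have h1 := hrec 1 le_rfl g hg x hx a
  have h2 := hrec 1 le_rfl (fun a => g a + c) (hg.add contDiff_const) x hx a
  have e : dunklOp α (fun a => g a + c) = dunklOp α g := by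
    rw [dunklOp_add α hgd (differentiable_const c), dunklOp_const]
    simp
  rw [e, ← h1] at h2
  simp [dunklB] at h2
  linarith

theorem tau_add_id {α : ℝ} {τ : ℝ → (ℝ → ℝ) → ℝ → ℝ} (hrec : DunklRec α τ) {g : ℝ → ℝ}
    (hg : ContDiff ℝ (⊤ : ℕ∞) g) (x : ℝ) (hx : x ≠ 0) (a : ℝ) :
    τ x (fun a => g a + a) a = τ x g a + a + dunklB α 1 x * (2 * (α + 1)) := by
  have hgd : Differentiable ℝ g := hg.differentiable (by simp)
  have h1 := hrec 2 (by norm_num) g hg x hx a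
  have h2 := hrec 2 (by norm_num) (fun a => g a + a) (hg.add contDiff_id) x hx a
  have e : dunklOp α (fun a => g a + a) = fun a => dunklOp α g a + 2 * (α + 1) := by
    rw [dunklOp_add α hgd differentiable_fun_id, dunklOp_id]
  have e0 : ∀ y, dunklB α 0 y = 1 := fun y => by simp [dunklB]
  have hint := integral_congr_ne_zero (p := -|x|) (q := |x|)
    (u := fun y => theta0 α x y *
            (τ y (dunklOp α (fun a => g a + a)) a -
              ∑ q ∈ Finset.range (2 - 1), dunklB α q y *
                (dunklOp α)^[q] (dunklOp α (fun a => g a + a)) a) *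
            |y| ^ (2 * α + 1))
    (v := fun y => theta0 α x y *
            (τ y (dunklOp α g) a -
              ∑ q ∈ Finset.range (2 - 1), dunklB α q y * (dunklOp α)^[q] (dunklOp α g) a) *
            |y| ^ (2 * α + 1))
    (fun y hy => by
      simp only [e]
      rw [tau_add_const hrec (dunklOp_contDiff α hg) _ y hy]
      simp [e0])
  rw [hint, ← h1] at h2
  simp only [Finset.sum_range_succ, Finset.sum_range_zero, e0, Function.iterate_zero, id,
    Function.iterate_one, e] at h2
  linarith

theorem tau_differentiable {α : ℝ} (hα : -1/2 < α) {τ : ℝ → (ℝ → ℝ) → ℝ → ℝ}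
    (hcomm : ∀ (y : ℝ) (g : ℝ → ℝ), ContDiff ℝ (⊤ : ℕ∞) g →
      dunklOp α (τ y g) = τ y (dunklOp α g))
    (hrec : DunklRec α τ) {g : ℝ → ℝ}
    (hg : ContDiff ℝ (⊤ : ℕ∞) g) (x : ℝ) (hx : x ≠ 0) : Differentiable ℝ (τ x g) := by
  intro a
  by_contra hnd
  have hgd : Differentiable ℝ g := hg.differentiable (by simp)
  have e : dunklOp α (fun a => g a + a) = fun a => dunklOp α g a + 2 * (α + 1) := by
    rw [dunklOp_add α hgd differentiable_fun_id, dunklOp_id]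
  have hfun : τ x (fun a => g a + a) =
      fun a => τ x g a + (a + dunklB α 1 x * (2 * (α + 1))) := by
    ext a
    rw [tau_add_id hrec hg x hx a]
    ring
  have h1 := congrFun (hcomm x g hg) a
  have h2 := congrFun (hcomm x (fun a => g a + a) (hg.add contDiff_id)) a
  rw [e, tau_add_const hrec (dunklOp_contDiff α hg) _ x hx, ← h1, hfun] at h2
  have hnd' : ¬ DifferentiableAt ℝ
      (fun a => τ x g a + (a + dunklB α 1 x * (2 * (α + 1)))) a := by
    intro h
    apply hnd
    have := h.sub (differentiableAt_id.add_const (dunklB α 1 x * (2 * (α + 1))))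
    have h3 : τ x g = (fun a => τ x g a + (a + dunklB α 1 x * (2 * (α + 1)))) -
        fun y => id y + dunklB α 1 x * (2 * (α + 1)) := by
      ext b
      simp
    rw [h3]
    exact this
  unfold dunklOp at h2
  split_ifs at h2 with h0
  · subst h0
    rw [deriv_zero_of_not_differentiableAt hnd, deriv_zero_of_not_differentiableAt hnd'] at h2
    linarith
  · rw [deriv_zero_of_not_differentiableAt hnd, deriv_zero_of_not_differentiableAt hnd'] at h2
    field_simp at h2
    have : a * 2 = 0 := by linear_combination (-1) * h2
    exact h0 (by linarith)

theorem dunklI_eq {α : ℝ} {τ : ℝ → (ℝ → ℝ) → ℝ → ℝ} (hrec : DunklRec α τ) (k : ℕ) :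
    ∀ {F : ℝ → ℝ}, ContDiff ℝ (⊤ : ℕ∞) F → ∀ x, x ≠ 0 → ∀ a,
      dunklI α τ ((dunklOp α)^[k] F) k x a =
        τ x F a - ∑ q ∈ Finset.range k, dunklB α q x * (dunklOp α)^[q] F a := by
  induction k with
  | zero => intro F hF x hx a; simp [dunklI]
  | succ k ih =>
    intro F hF x hx a
    rw [hrec (k + 1) (by omega) F hF x hx a]
    simp only [dunklI, Function.iterate_succ_apply, Nat.add_sub_cancel]
    refine integral_congr_ne_zero (fun y hy => ?_) _ _
    rw [ih (dunklOp_contDiff α hF) y hy a]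

theorem dunklOp_iterate_remainder {α : ℝ} (hα : -1/2 < α) {τ : ℝ → (ℝ → ℝ) → ℝ → ℝ}
    (hcomm : ∀ (y : ℝ) (g : ℝ → ℝ), ContDiff ℝ (⊤ : ℕ∞) g →
      dunklOp α (τ y g) = τ y (dunklOp α g))
    (hrec : DunklRec α τ) (c : ℕ → ℝ) (k : ℕ) (x : ℝ) (hx : x ≠ 0) (i : ℕ) :
    ∀ {F : ℝ → ℝ}, ContDiff ℝ (⊤ : ℕ∞) F →
      (dunklOp α)^[i] (fun a => τ x F a -
        ∑ q ∈ Finset.range k, c q * (dunklOp α)^[q] F a) =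
      fun a => τ x ((dunklOp α)^[i] F) a -
        ∑ q ∈ Finset.range k, c q * (dunklOp α)^[q] ((dunklOp α)^[i] F) a := by
  induction i with
  | zero => intro F hF; rfl
  | succ i ih =>
    intro F hF
    have hd : ∀ n, Differentiable ℝ ((dunklOp α)^[n] F) := fun n =>
      (dunklOp_iterate_contDiff α n hF).differentiable (by simp)
    rw [Function.iterate_succ_apply, Function.iterate_succ_apply,
      dunklOp_sub α (tau_differentiable hα hcomm hrec hF x hx)
        (Differentiable.fun_sum fun q _ => (hd q).const_mul _),
      dunklOp_sum α c _ hd, hcomm x F hF, ← ih (dunklOp_contDiff α hF)]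
    simp only [← Function.iterate_succ_apply' (dunklOp α), Function.iterate_succ_apply]

/-- `Λ_α^k (I_k(x,f)) = R_k(x,f)`, i.e. `I_k(x,f)` is a `k`-fold
`Λ_α`-antiderivative of the Taylor remainder `R_k(x,f) = τ_x f − Σ_{p<k} b_p(x) Λ_α^p f`;
here `τ` is the Dunkl translation, commuting with `Λ_α` and satisfying the recursion for
`R_k` (Lemma 3.3 of the paper), stated as hypotheses. -/
theorem stmt17 (α : ℝ) (hα : -1/2 < α)
    (τ : ℝ → (ℝ → ℝ) → ℝ → ℝ)
    (hcomm : ∀ (y : ℝ) (g : ℝ → ℝ), ContDiff ℝ (⊤ : ℕ∞) g → dunklOp α (τ y g) = τ y (dunklOp α g))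
    (hrec : ∀ (j : ℕ), 1 ≤ j → ∀ g : ℝ → ℝ, ContDiff ℝ (⊤ : ℕ∞) g → ∀ x : ℝ, x ≠ 0 → ∀ a : ℝ,
      τ x g a - ∑ q ∈ Finset.range j, dunklB α q x * (dunklOp α)^[q] g a =
        ∫ y in (-|x|)..|x|,
          theta0 α x y *
            (τ y (dunklOp α g) a -
              ∑ q ∈ Finset.range (j - 1), dunklB α q y * (dunklOp α)^[q] (dunklOp α g) a) *
            |y| ^ (2 * α + 1))
    (k : ℕ) (hk : 1 ≤ k) (f : ℝ → ℝ) (hf : ContDiff ℝ (⊤ : ℕ∞) f) (x : ℝ) (hx : x ≠ 0) (a : ℝ) :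
    (dunklOp α)^[k] (dunklI α τ f k x) a =
      τ x f a - ∑ p ∈ Finset.range k, dunklB α p x * (dunklOp α)^[p] f a := by
  obtain ⟨F, hF, rfl⟩ := dunklOp_iterate_surj hα k hf
  have h1 : dunklI α τ ((dunklOp α)^[k] F) k x = fun a =>
      τ x F a - ∑ q ∈ Finset.range k, dunklB α q x * (dunklOp α)^[q] F a :=
    funext fun a => dunklI_eq hrec k hF x hx a
  rw [h1, dunklOp_iterate_remainder hα hcomm hrec (fun q => dunklB α q x) k x hx k hF]
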